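/- Every symmetric matrix A over F_2 of rank k can be written as a sum of at most ⌊3k/2⌋ matrices of the form u uᵀ with u a column vector over F_2. -/

import Mathlib

open Matrix in
theorem exists_sum_vecMulVec_add {R n : Type*} [NonUnitalNonAssocSemiring R] {t : ℕ}
    {A : Matrix n n R}
    (h : ∃ u : Fin t → n → R, A = ∑ i, vecMulVec (u i) (u i)) (v : n → R) :
    ∃ u : Fin (t + 1) → n → R, A + vecMulVec v v = ∑ i, vecMulVec (u i) (u i) := by
  obtain ⟨u, rfl⟩ := h
  exact ⟨Fin.cons v u, by simp [Fin.sum_univ_succ, add_comm]⟩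

theorem Submodule.finrank_inf_ker_lt {K V : Type*} [Field K] [AddCommGroup V] [Module K V]
    [FiniteDimensional K V] {S : Submodule K V} (f : V →ₗ[K] K) {v : V} (hv : v ∈ S)
    (hfv : f v ≠ 0) :
    Module.finrank K ↥(S ⊓ LinearMap.ker f) < Module.finrank K S :=
  Submodule.finrank_lt_finrank_of_lt
    (lt_of_le_of_ne inf_le_left fun h => hfv (h.symm ▸ hv : v ∈ S ⊓ LinearMap.ker f).2)

open Matrix in
theorem Matrix.IsSymm.col_dotProduct {R n : Type*} [Fintype n] [NonUnitalNonAssocSemiring R]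
    {A : Matrix n n R} (hA : A.IsSymm) (i : n) (x : n → R) : A.col i ⬝ᵥ x = (A *ᵥ x) i :=
  congrArg (· ⬝ᵥ x) (funext fun j => hA.apply i j)

open Matrix in
theorem Matrix.col_mem_range_mulVecLin {R n : Type*} [Fintype n] [CommSemiring R]
    (A : Matrix n n R) (i : n) : A.col i ∈ LinearMap.range A.mulVecLin := by
  classical
  exact ⟨Pi.single i 1, by simp⟩

open Matrix in
/-- Elimination with a diagonal pivot lowers the rank. -/
theorem Matrix.IsSymm.rank_sub_vecMulVec_col_lt {K n : Type*} [Fintype n] [Field K]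
    {A : Matrix n n K} (hA : A.IsSymm) {i : n} (hi : A i i = 1) :
    (A - vecMulVec (A.col i) (A.col i)).rank < A.rank := by
  have hc := A.col_mem_range_mulVecLin i
  refine lt_of_le_of_lt (Submodule.finrank_mono ?_)
    (Submodule.finrank_inf_ker_lt (LinearMap.proj i) hc (by simp [hi]))
  rintro _ ⟨x, rfl⟩
  have hx : (A - vecMulVec (A.col i) (A.col i)) *ᵥ x = A *ᵥ x - (A *ᵥ x) i • A.col i := by
    rw [sub_mulVec, vecMulVec_mulVec, hA.col_dotProduct, op_smul_eq_smul]
  rw [mulVecLin_apply, hx]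
  exact ⟨sub_mem ⟨x, rfl⟩ (Submodule.smul_mem _ _ hc), by simp [hi]⟩

open Matrix in
/-- Elimination with a hyperbolic pivot lowers the rank by at least two. -/
theorem Matrix.IsSymm.rank_sub_vecMulVec_col_add_two_le {K n : Type*} [Fintype n] [Field K]
    {A : Matrix n n K} (hA : A.IsSymm) {i j : n} (hi : A i i = 0) (hj : A j j = 0)
    (hij : A i j = 1) :
    (A - vecMulVec (A.col i) (A.col j) - vecMulVec (A.col j) (A.col i)).rank + 2 ≤ A.rank := by
  have hji : A j i = 1 := by rw [hA.apply, hij]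
  have hci := A.col_mem_range_mulVecLin i
  have hcj := A.col_mem_range_mulVecLin j
  have h₁ := Submodule.finrank_inf_ker_lt (LinearMap.proj i) hcj (by simp [hij])
  have h₂ := Submodule.finrank_inf_ker_lt
    (S := LinearMap.range A.mulVecLin ⊓ LinearMap.ker (LinearMap.proj i))
    (LinearMap.proj j) (v := A.col i) ⟨hci, by simp [hi]⟩ (by simp [hji])
  have h₃ : (A - vecMulVec (A.col i) (A.col j) - vecMulVec (A.col j) (A.col i)).rank ≤ _ :=
    Submodule.finrank_mono (t := LinearMap.range A.mulVecLin ⊓ LinearMap.ker (LinearMap.proj i) ⊓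
      LinearMap.ker (LinearMap.proj j)) ?_
  · change _ < A.rank at h₁
    omega
  rintro _ ⟨x, rfl⟩
  have hx : (A - vecMulVec (A.col i) (A.col j) - vecMulVec (A.col j) (A.col i)) *ᵥ x =
      A *ᵥ x - (A *ᵥ x) j • A.col i - (A *ᵥ x) i • A.col j := by
    simp only [sub_mulVec, vecMulVec_mulVec, hA.col_dotProduct, op_smul_eq_smul]
  rw [mulVecLin_apply, hx]
  exact ⟨⟨sub_mem (sub_mem ⟨x, rfl⟩ (Submodule.smul_mem _ _ hci)) (Submodule.smul_mem _ _ hcj),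
    by simp [hi, hij]⟩, by simp [hj, hji]⟩

/-- Every symmetric matrix over F₂ of rank k is a sum of at most
⌊3k/2⌋ symmetric rank-one matrices u uᵀ. -/
theorem stmt4 (N k : ℕ) (A : Matrix (Fin N) (Fin N) (ZMod 2))
    (hsymm : A.IsSymm) (hk : A.rank = k) :
    ∃ t : ℕ, t ≤ 3 * k / 2 ∧
      ∃ u : Fin t → Fin N → ZMod 2,
        A = ∑ i : Fin t, Matrix.vecMulVec (u i) (u i) := by
  have h01 : ∀ a : ZMod 2, a ≠ 0 → a = 1 := by decide
  induction k using Nat.strong_induction_on generalizing A with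
  | _ k ih =>
  by_cases hd : ∃ i, A i i ≠ 0
  · obtain ⟨i, hi⟩ := hd
    have hr := hsymm.rank_sub_vecMulVec_col_lt (h01 _ hi)
    obtain ⟨t, ht, h⟩ := ih _ (hk ▸ hr) _
      (hsymm.sub (Matrix.transpose_vecMulVec _ _)) rfl
    refine ⟨t + 1, by omega, ?_⟩
    simpa using exists_sum_vecMulVec_add h (A.col i)
  push Not at hd
  by_cases ho : ∃ i j, A i j ≠ 0
  · obtain ⟨i, j, hij⟩ := ho
    have hr := hsymm.rank_sub_vecMulVec_col_add_two_le (hd i) (hd j) (h01 _ hij)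
    obtain ⟨t, ht, h⟩ := ih _ (hk ▸ lt_of_lt_of_le (Nat.lt_add_of_pos_right two_pos) hr) _
      (by
        rw [Matrix.IsSymm, Matrix.transpose_sub, Matrix.transpose_sub, hsymm,
          Matrix.transpose_vecMulVec, Matrix.transpose_vecMulVec, sub_right_comm]) rfl
    refine ⟨t + 3, by omega, ?_⟩
    convert exists_sum_vecMulVec_add (exists_sum_vecMulVec_add
      (exists_sum_vecMulVec_add h (A.col i)) (A.col j)) (A.col i + A.col j) using 3
    ext p q
    simp only [Matrix.add_apply, Matrix.sub_apply, Matrix.vecMulVec_apply, Pi.add_apply]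
    generalize A p q = a, A.col i p = b, A.col j p = c, A.col i q = d, A.col j q = e
    revert a b c d e
    decide
  · push Not at ho
    exact ⟨0, Nat.zero_le _, Fin.elim0, by ext i j; simp [ho]⟩
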